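/- arXiv:1204.4855 — 3 statements merged into one kernel-verified Lean document; each statement's English description precedes it below -/
import Mathlib

section
/- Let q ≥ 1 be an integer and let i₁, i₂, i₃ ≥ 1 and 1 ≤ s₁, s₂, s₃ ≤ q be integers. Then the two conditions ∏_{k=0}^{i₁-1} ∏_{l=0}^{s₁-1} ( h^{(q)}_{i₃,s₃} − h^{(q)}_{i₁+i₂−2k−1, s₁+s₂−2l−1} ) = 0 and ∏_{k=0}^{i₂-1} ∏_{l=0}^{s₂-1} ( h^{(q)}_{i₃,s₃} − h^{(q)}_{i₁+i₂−2k−1, s₁+s₂−2l−1} ) = 0 hold simultaneously if and only if there exist i ∈ A_{i₁,i₂} and s ∈ A_{s₁,s₂} such that h^{(q)}_{i₃,s₃} = h^{(q)}_{i,s}. -/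
/-- The conformal weight `h^{(q)}_{a,b} = ((a·q − b)² − (q − 1)²)/(4q)` as a rational number,
for an integer `q ≥ 1` and integers `a`, `b`. -/
noncomputable def virWeight (q : ℕ) (a b : ℤ) : ℚ :=
  (((a : ℚ) * q - b) ^ 2 - ((q : ℚ) - 1) ^ 2) / (4 * q)

theorem virWeight_eq_iff {q : ℕ} (hq : 1 ≤ q) (a b c d : ℤ) :
    virWeight q a b = virWeight q c d ↔ a * q - b = c * q - d ∨ a * q - b = -(c * q - d) := by
  have hq' : (4 * (q : ℚ)) ≠ 0 := by positivity
  rw [virWeight, virWeight, div_left_inj' hq', sub_left_inj, sq_eq_sq_iff_eq_or_eq_neg]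
  norm_cast

/-- The Frenkel–Zhu product vanishes iff one of its factors, indexed by the values of the
two labels, does. -/
theorem prod_virWeight_sub_eq_zero_iff (q m n : ℕ) (x : ℚ) (u v : ℤ) :
    ∏ k ∈ Finset.range m, ∏ l ∈ Finset.range n,
        (x - virWeight q (u - 2 * k - 1) (v - 2 * l - 1)) = 0 ↔
      ∃ a b : ℤ, (u - 2 * m + 1 ≤ a ∧ a ≤ u - 1 ∧ a % 2 = (u - 1) % 2) ∧
        (v - 2 * n + 1 ≤ b ∧ b ≤ v - 1 ∧ b % 2 = (v - 1) % 2) ∧ x = virWeight q a b := by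
  simp only [Finset.prod_eq_zero_iff, Finset.mem_range, sub_eq_zero]
  constructor
  · rintro ⟨k, hk, l, hl, h⟩
    exact ⟨_, _, by omega, by omega, h⟩
  · rintro ⟨a, b, ha, hb, h⟩
    refine ⟨((u - 1 - a) / 2).toNat, by omega, ((v - 1 - b) / 2).toNat, by omega, ?_⟩
    convert h using 2 <;> omega

/-- Let `(a, b)` and `(a', b')` be labels of equal weight, with `a` and `b'` in the admissible
ranges bounded below by `n - m + 1` and `s - t + 1`. If `s ≤ q`, then `b` or `a'` satisfies the
corresponding lower bound too, so one of the two labels is admissible in both coordinates. -/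
theorem admissible_of_virWeight_eq {q : ℕ} (hq : 1 ≤ q) {m n s t a b a' b' : ℤ}
    (hsq : s ≤ q)
    (ha : n - m + 1 ≤ a) (hpar : a % 2 = a' % 2)
    (hb : t - s + 1 ≤ b) (hb' : s - t + 1 ≤ b') (hb'_le : b' ≤ s + t - 1)
    (h : virWeight q a b = virWeight q a' b') :
    s - t - 1 < b ∨ n - m - 1 < a' := by
  by_contra! hbad
  obtain ⟨hbad, hbad'⟩ := hbad
  have hq' : (1 : ℤ) ≤ q := by exact_mod_cast hq
  rcases (virWeight_eq_iff hq a b a' b').1 h with h | h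
  · have : (2 : ℤ) ≤ a - a' := by omega
    nlinarith
  · have hpos : 0 < a + a' := by
      by_contra! hle
      nlinarith
    have : (2 : ℤ) ≤ a + a' := by omega
    nlinarith

/-- The two Frenkel–Zhu product-vanishing conditions hold simultaneously if and only if
`h^{(q)}_{i₃,s₃} = h^{(q)}_{i,s}` for some `i ∈ A_{i₁,i₂}` and `s ∈ A_{s₁,s₂}`. -/
theorem virasoro_fusion_vanishing_iff
    (q i₁ i₂ i₃ s₁ s₂ s₃ : ℕ)
    (hq : 1 ≤ q) (hi₁ : 1 ≤ i₁) (hi₂ : 1 ≤ i₂) (hi₃ : 1 ≤ i₃)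
    (hs₁ : 1 ≤ s₁) (hs₁q : s₁ ≤ q)
    (hs₂ : 1 ≤ s₂) (hs₂q : s₂ ≤ q)
    (hs₃ : 1 ≤ s₃) (hs₃q : s₃ ≤ q) :
    ((∏ k ∈ Finset.range i₁, ∏ l ∈ Finset.range s₁,
        (virWeight q i₃ s₃ -
          virWeight q ((i₁ : ℤ) + i₂ - 2 * k - 1) ((s₁ : ℤ) + s₂ - 2 * l - 1)) = 0) ∧
      (∏ k ∈ Finset.range i₂, ∏ l ∈ Finset.range s₂,
        (virWeight q i₃ s₃ -
          virWeight q ((i₁ : ℤ) + i₂ - 2 * k - 1) ((s₁ : ℤ) + s₂ - 2 * l - 1)) = 0))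
    ↔ ∃ i s : ℤ,
        (|(i₁ : ℤ) - i₂| + 1 ≤ i ∧ i ≤ (i₁ : ℤ) + i₂ - 1 ∧
          i % 2 = ((i₁ : ℤ) + i₂ - 1) % 2) ∧
        (|(s₁ : ℤ) - s₂| + 1 ≤ s ∧ s ≤ (s₁ : ℤ) + s₂ - 1 ∧
          s % 2 = ((s₁ : ℤ) + s₂ - 1) % 2) ∧
        virWeight q i₃ s₃ = virWeight q i s := by
  have abs_le_sub {x y z : ℤ} (h₁ : x - y + 1 ≤ z) (h₂ : y - x + 1 ≤ z) : |x - y| + 1 ≤ z := by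
    rcases abs_cases (x - y) with h | h <;> omega
  rw [prod_virWeight_sub_eq_zero_iff, prod_virWeight_sub_eq_zero_iff]
  constructor
  · rintro ⟨⟨a, b, ⟨ha, ha_le, hap⟩, ⟨hb, hb_le, hbp⟩, h⟩,
      ⟨a', b', ⟨ha', ha'_le, hap'⟩, ⟨hb', hb'_le, hbp'⟩, h'⟩⟩
    rcases le_total i₁ i₂ with hi | hi <;> rcases le_total s₁ s₂ with hs | hs
    · exact ⟨a, b, ⟨abs_le_sub (by omega) (by omega), ha_le, hap⟩,
        ⟨abs_le_sub (by omega) (by omega), hb_le, hbp⟩, h⟩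
    · rcases admissible_of_virWeight_eq hq (m := i₁) (n := i₂) (s := s₁) (t := s₂)
        (by omega) (by omega) (by omega) (by omega) (by omega) (by omega)
        (h.symm.trans h') with hgood | hgood
      · exact ⟨a, b, ⟨abs_le_sub (by omega) (by omega), ha_le, hap⟩,
        ⟨abs_le_sub (by omega) (by omega), hb_le, hbp⟩, h⟩
      · exact ⟨a', b', ⟨abs_le_sub (by omega) (by omega), ha'_le, hap'⟩,
        ⟨abs_le_sub (by omega) (by omega), hb'_le, hbp'⟩, h'⟩
    · rcases admissible_of_virWeight_eq hq (m := i₂) (n := i₁) (s := s₂) (t := s₁)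
        (by omega) (by omega) (by omega) (by omega) (by omega) (by omega)
        (h'.symm.trans h) with hgood | hgood
      · exact ⟨a', b', ⟨abs_le_sub (by omega) (by omega), ha'_le, hap'⟩,
        ⟨abs_le_sub (by omega) (by omega), hb'_le, hbp'⟩, h'⟩
      · exact ⟨a, b, ⟨abs_le_sub (by omega) (by omega), ha_le, hap⟩,
        ⟨abs_le_sub (by omega) (by omega), hb_le, hbp⟩, h⟩
    · exact ⟨a', b', ⟨abs_le_sub (by omega) (by omega), ha'_le, hap'⟩,
        ⟨abs_le_sub (by omega) (by omega), hb'_le, hbp'⟩, h'⟩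
  · rintro ⟨i, s, ⟨hi, hi_le, hip⟩, ⟨hs, hs_le, hsp⟩, h⟩
    have hi' := le_abs_self ((i₁ : ℤ) - i₂)
    have hi'' := neg_le_abs ((i₁ : ℤ) - i₂)
    have hs' := le_abs_self ((s₁ : ℤ) - s₂)
    have hs'' := neg_le_abs ((s₁ : ℤ) - s₂)
    exact ⟨⟨i, s, ⟨by omega, hi_le, hip⟩, ⟨by omega, hs_le, hsp⟩, h⟩,
      ⟨i, s, ⟨by omega, hi_le, hip⟩, ⟨by omega, hs_le, hsp⟩, h⟩⟩
end

section
/- Let q ≥ 1, α ≥ 1, β ≥ 1 be integers, let k, l be integers with 0 ≤ k ≤ α−1 and 0 ≤ l ≤ β−1, and let σ, h be real numbers. Then Q^{α,β}_{k,l}( −g_q(σ), g_q(αq−β) − h ; q ) = ( h − g_q(σ + (α−2k−1)q − (β−2l−1)) ) · ( h − g_q(σ − (α−2k−1)q + (β−2l−1)) ). -/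
/-- `g_q(τ) = (τ² − (q−1)²)/(4q)` for an integer `q ≥ 1` and a real number `τ`. -/
noncomputable def gWeight (q : ℕ) (τ : ℝ) : ℝ :=
  (τ ^ 2 - ((q : ℝ) - 1) ^ 2) / (4 * q)

/-- The Iohara–Koga polynomial `Q^{α,β}_{k,l}(a,b;ξ)` evaluated at `ξ = q`,
with `ξ^{1/2} = √q`. -/
noncomputable def Qfactor (α β k l : ℕ) (a b : ℝ) (q : ℕ) : ℝ :=
  ((b - a) - ((k : ℝ) * Real.sqrt q - (l : ℝ) / Real.sqrt q) *
      (((α : ℝ) - k) * Real.sqrt q - ((β : ℝ) - l) / Real.sqrt q)) *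
    ((b - a) - (((k : ℝ) + 1) * Real.sqrt q - ((l : ℝ) + 1) / Real.sqrt q) *
      (((α : ℝ) - k - 1) * Real.sqrt q - ((β : ℝ) - l - 1) / Real.sqrt q)) +
  (((α : ℝ) - 2 * k - 1) * Real.sqrt q - ((β : ℝ) - 2 * l - 1) / Real.sqrt q) ^ 2 * a

/-- The factorization of `Q^{α,β}_{k,l}( −g_q(σ), g_q(αq−β) − h ; q )` into a product of two
differences of Virasoro highest weights. -/
theorem Qfactor_eq_weight_differences
    (q α β k l : ℕ) (hq : 1 ≤ q) (hα : 1 ≤ α) (hβ : 1 ≤ β)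
    (hk : k ≤ α - 1) (hl : l ≤ β - 1) (σ h : ℝ) :
    Qfactor α β k l (-(gWeight q σ)) (gWeight q ((α : ℝ) * q - β) - h) q =
      (h - gWeight q (σ + ((α : ℝ) - 2 * k - 1) * q - ((β : ℝ) - 2 * l - 1))) *
      (h - gWeight q (σ - ((α : ℝ) - 2 * k - 1) * q + ((β : ℝ) - 2 * l - 1))) := by
  have hpos : (0 : ℝ) < q := by exact_mod_cast hq
  have hs : (q : ℝ) = √(q : ℝ) ^ 2 := (Real.sq_sqrt hpos.le).symm
  have hs0 : √(q : ℝ) ≠ 0 := (Real.sqrt_pos.mpr hpos).ne'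
  unfold Qfactor gWeight
  generalize √(q : ℝ) = s at hs hs0 ⊢
  rw [hs]
  field_simp
  ring
end

section
/- Let q ≥ 1, α ≥ 1, β ≥ 1 be integers and let σ, h be real numbers. Then ∏_{k=0}^{α−1} ∏_{l=0}^{β−1} Q^{α,β}_{k,l}( −g_q(σ), g_q(αq−β) − h ; q ) = ( ∏_{k=0}^{α−1} ∏_{l=0}^{β−1} ( h − g_q(σ + (α−2k−1)q − (β−2l−1)) ) )². In particular, the left-hand product vanishes if and only if h = g_q(σ + (α−2k−1)q − (β−2l−1)) for some 0 ≤ k ≤ α−1 and 0 ≤ l ≤ β−1. -/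
/-- Each factor `Q_{k,l}` is the product of the weight differences for the two opposite shifts. -/
theorem Qfactor_eq_mul (q α β k l : ℕ) (hq : 1 ≤ q) (σ h : ℝ) :
    Qfactor α β k l (-(gWeight q σ)) (gWeight q ((α : ℝ) * q - β) - h) q =
      (h - gWeight q (σ + ((α : ℝ) - 2 * k - 1) * q - ((β : ℝ) - 2 * l - 1))) *
      (h - gWeight q (σ - ((α : ℝ) - 2 * k - 1) * q + ((β : ℝ) - 2 * l - 1))) := by
  have hq0 : (0 : ℝ) < q := by exact_mod_cast hq
  obtain ⟨s, hs, hsq⟩ : ∃ s : ℝ, 0 < s ∧ (q : ℝ) = s ^ 2 :=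
    ⟨Real.sqrt q, Real.sqrt_pos.2 hq0, (Real.sq_sqrt hq0.le).symm⟩
  have hs0 : s ≠ 0 := hs.ne'
  unfold Qfactor gWeight
  rw [hsq, Real.sqrt_sq hs.le]
  field_simp
  ring

/-- Reflecting both indices negates the shift, so the two products of weight differences agree. -/
theorem prod_sub_gWeight_reflect (q α β : ℕ) (σ h : ℝ) :
    (∏ k ∈ Finset.range α, ∏ l ∈ Finset.range β,
        (h - gWeight q (σ - ((α : ℝ) - 2 * k - 1) * q + ((β : ℝ) - 2 * l - 1)))) =
      ∏ k ∈ Finset.range α, ∏ l ∈ Finset.range β,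
        (h - gWeight q (σ + ((α : ℝ) - 2 * k - 1) * q - ((β : ℝ) - 2 * l - 1))) := by
  have cast_reflect {n i : ℕ} (hi : i < n) : ((n - 1 - i : ℕ) : ℝ) = n - 1 - i := by
    rw [Nat.cast_sub (by omega), Nat.cast_sub (by omega), Nat.cast_one]
  rw [← Finset.prod_range_reflect]
  refine Finset.prod_congr rfl fun k hk => ?_
  rw [← Finset.prod_range_reflect]
  refine Finset.prod_congr rfl fun l hl => ?_
  rw [cast_reflect (Finset.mem_range.1 hk), cast_reflect (Finset.mem_range.1 hl)]
  congr 2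
  ring

/-- The full product of the `Q^{α,β}_{k,l}` is the square of the product of weight differences;
in particular it vanishes iff `h` is one of the shifted weights. -/
theorem Qfactor_prod_eq_sq_and_vanishing_iff
    (q α β : ℕ) (hq : 1 ≤ q) (hα : 1 ≤ α) (hβ : 1 ≤ β) (σ h : ℝ) :
    (∏ k ∈ Finset.range α, ∏ l ∈ Finset.range β,
        Qfactor α β k l (-(gWeight q σ)) (gWeight q ((α : ℝ) * q - β) - h) q) =
      (∏ k ∈ Finset.range α, ∏ l ∈ Finset.range β,
        (h - gWeight q (σ + ((α : ℝ) - 2 * k - 1) * q - ((β : ℝ) - 2 * l - 1)))) ^ 2 ∧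
    ((∏ k ∈ Finset.range α, ∏ l ∈ Finset.range β,
        Qfactor α β k l (-(gWeight q σ)) (gWeight q ((α : ℝ) * q - β) - h) q) = 0 ↔
      ∃ k < α, ∃ l < β,
        h = gWeight q (σ + ((α : ℝ) - 2 * k - 1) * q - ((β : ℝ) - 2 * l - 1))) := by
  have key : (∏ k ∈ Finset.range α, ∏ l ∈ Finset.range β,
        Qfactor α β k l (-(gWeight q σ)) (gWeight q ((α : ℝ) * q - β) - h) q) =
      (∏ k ∈ Finset.range α, ∏ l ∈ Finset.range β,
        (h - gWeight q (σ + ((α : ℝ) - 2 * k - 1) * q - ((β : ℝ) - 2 * l - 1)))) ^ 2 := by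
    simp only [Qfactor_eq_mul q α β _ _ hq, Finset.prod_mul_distrib]
    rw [prod_sub_gWeight_reflect, sq]
  refine ⟨key, ?_⟩
  rw [key, sq_eq_zero_iff]
  simp only [Finset.prod_eq_zero_iff, Finset.mem_range, sub_eq_zero]
end
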